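/- arXiv:2106.05492 — 4 statements merged into one kernel-verified Lean document; each statement's English description precedes it below -/
import Mathlib

section
/- (Blackwell approachability rate for the negative orthant.) Let S = (−∞,0]^d ⊆ ℝ^d, let (w_t)_{t≥1} be a sequence in ℝ^d, let v̄_t = (1/t) Σ_{s=1}^t w_s, and let a_t be the Euclidean projection of v̄_t onto S (so a_t has coordinates min((v̄_t)_j, 0)). Let D > 0 and suppose dist(w_1, S) ≤ D and, for every t ≥ 1, ⟨v̄_t − a_t, w_{t+1}⟩ ≤ 0 and ‖w_{t+1} − a_t‖ ≤ D. Then for every n ≥ 1, dist(v̄_n, S)² ≤ D²/n, i.e., dist(v̄_n, S) ≤ D/√n. -/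
open scoped RealInnerProductSpace

/-- Blackwell approachability rate for the negative orthant:
with `v̄_t = (1/t) ∑_{s=1}^t w_s` and `a_t` the projection of `v̄_t` onto the
negative orthant `S`, if `dist(w_1, S) ≤ D`, `⟪v̄_t − a_t, w_{t+1}⟫ ≤ 0` and
`‖w_{t+1} − a_t‖ ≤ D` for all `t ≥ 1`, then `dist(v̄_n, S)² ≤ D²/n` for all
`n ≥ 1`. -/
theorem blackwell_approachability_rate
    {d : ℕ} (S : Set (EuclideanSpace ℝ (Fin d)))
    (hS : S = {z | ∀ j, z j ≤ 0})
    (w : ℕ → EuclideanSpace ℝ (Fin d))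
    (vbar : ℕ → EuclideanSpace ℝ (Fin d))
    (hvbar : ∀ t, vbar t = (t : ℝ)⁻¹ • ∑ s ∈ Finset.range t, w (s + 1))
    (a : ℕ → EuclideanSpace ℝ (Fin d))
    (ha : ∀ t j, a t j = min (vbar t j) 0)
    (D : ℝ) (hD : 0 < D)
    (hw1 : Metric.infDist (w 1) S ≤ D)
    (hinner : ∀ t, 1 ≤ t → ⟪vbar t - a t, w (t + 1)⟫ ≤ 0)
    (hbound : ∀ t, 1 ≤ t → ‖w (t + 1) - a t‖ ≤ D) :
    ∀ n : ℕ, 1 ≤ n → Metric.infDist (vbar n) S ^ 2 ≤ D ^ 2 / n := by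
  have haS : ∀ t, a t ∈ S := by
    intro t
    rw [hS]
    intro j
    rw [ha]
    exact min_le_right _ _
  have hdist : ∀ t, Metric.infDist (vbar t) S = ‖vbar t - a t‖ := by
    intro t
    apply le_antisymm
    · rw [← dist_eq_norm]
      exact Metric.infDist_le_dist_of_mem (haS t)
    · rw [Metric.le_infDist ⟨a t, haS t⟩]
      intro y hy
      rw [hS] at hy
      rw [dist_eq_norm, EuclideanSpace.norm_eq, EuclideanSpace.norm_eq]
      apply Real.sqrt_le_sqrt
      apply Finset.sum_le_sum
      intro j _
      have hyj : y j ≤ 0 := hy j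
      simp only [PiLp.sub_apply, ha, Real.norm_eq_abs, sq_abs]
      rcases le_total (vbar t j) 0 with h | h
      · rw [min_eq_left h]
        nlinarith [sq_nonneg (vbar t j - y j)]
      · rw [min_eq_right h]
        nlinarith
  have horth : ∀ t, ⟪vbar t - a t, a t⟫ = 0 := by
    intro t
    rw [PiLp.inner_apply]
    apply Finset.sum_eq_zero
    intro j _
    simp only [PiLp.sub_apply, ha]
    rcases le_total (vbar t j) 0 with h | h
    · simp [min_eq_left h]
    · simp [min_eq_right h]
  have key : ∀ n : ℕ, 1 ≤ n → (n : ℝ) ^ 2 * Metric.infDist (vbar n) S ^ 2 ≤ n * D ^ 2 := by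
    intro n hn
    induction n, hn using Nat.le_induction with
    | base =>
      have h1 : vbar 1 = w 1 := by simp [hvbar]
      have := pow_le_pow_left₀ Metric.infDist_nonneg hw1 2
      rw [h1]
      simpa using this
    | succ t ht ih =>
      have htpos : (0 : ℝ) < t := by exact_mod_cast ht
      have hs : ((t : ℝ) + 1) • (vbar (t + 1) - a t)
          = (t : ℝ) • (vbar t - a t) + (w (t + 1) - a t) := by
        have e1 : ((t : ℝ) + 1) • vbar (t + 1) = (t : ℝ) • vbar t + w (t + 1) := by
          rw [hvbar, hvbar, Finset.sum_range_succ, smul_smul, smul_smul, Nat.cast_succ,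
            mul_inv_cancel₀ (by positivity), mul_inv_cancel₀ (by positivity), one_smul, one_smul]
        rw [smul_sub, e1]
        module
      have hle : Metric.infDist (vbar (t + 1)) S ≤ ‖vbar (t + 1) - a t‖ := by
        rw [← dist_eq_norm]
        exact Metric.infDist_le_dist_of_mem (haS t)
      have hle2 := pow_le_pow_left₀ Metric.infDist_nonneg hle 2
      have hn2 : ((t : ℝ) + 1) ^ 2 * ‖vbar (t + 1) - a t‖ ^ 2
          = (t : ℝ) ^ 2 * ‖vbar t - a t‖ ^ 2 + 2 * (t * ⟪vbar t - a t, w (t + 1) - a t⟫)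
            + ‖w (t + 1) - a t‖ ^ 2 := by
        have := congrArg (fun x => ‖x‖ ^ 2) hs
        rw [norm_add_sq_real, norm_smul, norm_smul, mul_pow, mul_pow, real_inner_smul_left,
          Real.norm_eq_abs, Real.norm_eq_abs, sq_abs, sq_abs] at this
        exact this
      have hin : ⟪vbar t - a t, w (t + 1) - a t⟫ ≤ 0 := by
        rw [inner_sub_right, horth, sub_zero]
        exact hinner t ht
      have hb := pow_le_pow_left₀ (norm_nonneg _) (hbound t ht) 2
      have hm := mul_nonpos_of_nonneg_of_nonpos htpos.le hin
      have hl := mul_le_mul_of_nonneg_left hle2 (sq_nonneg ((t : ℝ) + 1))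
      rw [hdist t] at ih
      push_cast
      linarith
  intro n hn
  have hnpos : (0 : ℝ) < n := by exact_mod_cast hn
  rw [le_div_iff₀ hnpos]
  have := key n hn
  apply le_of_mul_le_mul_left _ hnpos
  linarith
end

section
/- (Smoothness bound extends to approximate coarse-correlated equilibria.) Consider a finite cost-minimization game with n players that is (λ, μ)-smooth with μ < 1. Let ε ≥ 0 and let σ be a joint distribution on A that is an ε-CCE in costs, i.e., for every player i and every action ã_i ∈ A_i, c̄_i(σ) ≤ c̄_i(ã_i, σ_{-i}) + ε. Then for every action profile a* ∈ A, the expected total cost satisfies C̄(σ) ≤ (λ · C(a*) + n ε) / (1 − μ). In particular, taking a* to be a total-cost minimizer, C̄(σ) ≤ (λ/(1−μ)) · min_{a ∈ A} C(a) + n ε/(1−μ). -/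
/-- Smoothness bound extends to approximate CCE: in a
`(λ, μ)`-smooth finite cost-minimization game with `μ < 1`, if `σ` is an
`ε`-CCE in costs, then for every action profile `a*` the expected total cost
satisfies `C̄(σ) ≤ (λ C(a*) + n ε) / (1 − μ)`.  In particular this holds with
`a*` a total-cost minimizer. -/
theorem smooth_game_eps_cce_cost_bound
    {n : ℕ} {A : Fin n → Type*} [∀ i, Fintype (A i)] [∀ i, Nonempty (A i)]
    (c : Fin n → (∀ j, A j) → ℝ)
    (lam mu : ℝ) (hmu : mu < 1)
    (hsmooth : ∀ astar aprof : ∀ j, A j,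
      (∑ i, c i (Function.update aprof i (astar i))) ≤
        lam * (∑ i, c i astar) + mu * (∑ i, c i aprof))
    (ε : ℝ) (hε : 0 ≤ ε)
    (σ : (∀ j, A j) → ℝ) (hσ_nonneg : ∀ a, 0 ≤ σ a) (hσ_sum : ∑ a, σ a = 1)
    (hcce : ∀ i : Fin n, ∀ ai : A i,
      (∑ a, σ a * c i a) ≤ (∑ a, σ a * c i (Function.update a i ai)) + ε) :
    ∀ astar : ∀ j, A j,
      (∑ i, ∑ a, σ a * c i a) ≤ (lam * (∑ i, c i astar) + n * ε) / (1 - mu) := by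
  intro astar
  rw [le_div_iff₀ (by linarith)]
  have h1 : (∑ i, ∑ a, σ a * c i a) ≤
      ∑ i, ((∑ a, σ a * c i (Function.update a i (astar i))) + ε) :=
    Finset.sum_le_sum fun i _ => hcce i (astar i)
  rw [Finset.sum_add_distrib, Finset.sum_comm (f := fun i a =>
    σ a * c i (Function.update a i (astar i)))] at h1
  have h2 : (∑ a, ∑ i, σ a * c i (Function.update a i (astar i))) ≤
      ∑ a, (σ a * (lam * (∑ i, c i astar)) + mu * (σ a * ∑ i, c i a)) := by
    refine Finset.sum_le_sum fun a _ => ?_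
    rw [← Finset.mul_sum]
    have := mul_le_mul_of_nonneg_left (hsmooth astar a) (hσ_nonneg a)
    linarith
  have h3 : (∑ i, ∑ a, σ a * c i a) = ∑ a, σ a * ∑ i, c i a := by
    rw [Finset.sum_comm]
    simp only [Finset.mul_sum]
  rw [Finset.sum_add_distrib, ← Finset.sum_mul, ← Finset.mul_sum, hσ_sum, ← h3] at h2
  have h4 : (∑ _i : Fin n, ε) = n * ε := by simp
  rw [h4] at h1
  linarith
end

section
/- Fix a finite game with utilities u_1, …, u_n, a nonnegative weight vector β ∈ ℝ_+^{m+1}, and define the costs c_i as in the weighted-cost construction. Then for every coarse-correlated equilibrium x* of the game with utilities u, the expected total constructed cost satisfies Σ_{i=1}^n c̄_i(x*) ≤ − β_{m+1} · ν̄(x*). -/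
/-- Expected utility `ū_i(x) = E_{a∼x}[u_i(a)]` of player `i` under joint
distribution `x`. -/
noncomputable def ubar {n : ℕ} {A : Fin n → Type*} [∀ i, Fintype (A i)]
    (u : ∀ i : Fin n, (∀ j, A j) → ℝ) (i : Fin n) (x : (∀ j, A j) → ℝ) : ℝ :=
  ∑ a, x a * u i a

/-- Expected deviation utility `ū_i(b, x_{-i}) = E_{a∼x}[u_i(b, a_{-i})]`. -/
noncomputable def udev {n : ℕ} {A : Fin n → Type*} [∀ i, Fintype (A i)]
    (u : ∀ i : Fin n, (∀ j, A j) → ℝ) (i : Fin n) (b : A i)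
    (x : (∀ j, A j) → ℝ) : ℝ :=
  ∑ a, x a * u i (Function.update a i b)

/-- Expected objective `ν̄(x) = E_{a∼x}[ν(a)]`. -/
noncomputable def nubar {n : ℕ} {A : Fin n → Type*} [∀ i, Fintype (A i)]
    (ν : (∀ j, A j) → ℝ) (x : (∀ j, A j) → ℝ) : ℝ :=
  ∑ a, x a * ν a

open scoped Classical in
/-- The weighted-cost construction:
`c_i(x) = − β_{m+1} ν̄(x)/n − ‖β_i‖₁ (ū_i(x) − ū_i(β_i/‖β_i‖₁, x_{-i}))`,
with the second term taken to be `0` when `‖β_i‖₁ = 0`. -/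
noncomputable def wcost {n : ℕ} {A : Fin n → Type*} [∀ i, Fintype (A i)]
    (u : ∀ i : Fin n, (∀ j, A j) → ℝ) (ν : (∀ j, A j) → ℝ)
    (β : ∀ i : Fin n, A i → ℝ) (βlast : ℝ)
    (i : Fin n) (x : (∀ j, A j) → ℝ) : ℝ :=
  -(βlast * nubar ν x) / n -
    (if (∑ b, β i b) = 0 then 0
     else (∑ b, β i b) *
       (ubar u i x - ∑ b, (β i b / ∑ b', β i b') * udev u i b x))

/-- for every coarse-correlated equilibrium `x*` of the game with
utilities `u`, the expected total constructed cost satisfies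
`∑_i c̄_i(x*) ≤ − β_{m+1} ν̄(x*)`. -/
theorem cce_total_weighted_cost_bound
    {n : ℕ} {A : Fin n → Type*} [∀ i, Fintype (A i)] [∀ i, Nonempty (A i)]
    (hn : 0 < n)
    (u : ∀ i : Fin n, (∀ j, A j) → ℝ) (ν : (∀ j, A j) → ℝ)
    (β : ∀ i : Fin n, A i → ℝ) (hβ : ∀ i b, 0 ≤ β i b)
    (βlast : ℝ) (hβlast : 0 ≤ βlast)
    (x : (∀ j, A j) → ℝ) (hx_nonneg : ∀ a, 0 ≤ x a) (hx_sum : ∑ a, x a = 1)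
    (hcce : ∀ i : Fin n, ∀ b : A i, ubar u i x ≥ udev u i b x) :
    (∑ i, wcost u ν β βlast i x) ≤ -(βlast * nubar ν x) := by
  have key : ∀ i : Fin n, wcost u ν β βlast i x ≤ -(βlast * nubar ν x) / n := by
    intro i
    unfold wcost
    apply sub_le_self
    split_ifs with h
    · exact le_rfl
    · have hS : 0 ≤ ∑ b, β i b := Finset.sum_nonneg fun b _ => hβ i b
      apply mul_nonneg hS
      rw [sub_nonneg]
      calc ∑ b, (β i b / ∑ b', β i b') * udev u i b x
          ≤ ∑ b, (β i b / ∑ b', β i b') * ubar u i x :=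
            Finset.sum_le_sum fun b _ =>
              mul_le_mul_of_nonneg_left (hcce i b) (div_nonneg (hβ i b) hS)
        _ = ubar u i x := by
            rw [← Finset.sum_mul, ← Finset.sum_div, div_self h, one_mul]
  have hn' : (n : ℝ) ≠ 0 := by exact_mod_cast hn.ne'
  calc ∑ i, wcost u ν β βlast i x
      ≤ ∑ _i : Fin n, -(βlast * nubar ν x) / n := Finset.sum_le_sum fun i _ => key i
    _ = -(βlast * nubar ν x) := by
        rw [Finset.sum_const, Finset.card_univ, Fintype.card_fin, nsmul_eq_mul]
        field_simp
end

section
/- (Fragility of Stackelberg best responses.) There exists a two-player Stackelberg game with countable action sets A_0 (leader) and A_1 (follower) and bounded utilities u_0, u_1 : A_0 × A_1 → ℝ, a leader mixed strategy x_0 ∈ Δ(A_0), a sequence of leader mixed strategies x_0^(1), x_0^(2), … ∈ Δ(A_0) with ‖x_0 − x_0^(t)‖_∞ → 0 as t → ∞, and a constant c > 0, such that BR(x_0) and every BR(x_0^(t)) are nonempty and, for all t, min_{a_1 ∈ BR(x_0)} ū_0(x_0, a_1) − max_{a_1 ∈ BR(x_0^(t))} ū_0(x_0, a_1) ≥ c.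 -/
/-- Expected utility `ū(x₀, a₁) = E_{a₀∼x₀}[u(a₀, a₁)]` of a mixed leader
strategy `x₀` against a follower action `a₁`. -/
noncomputable def leaderExp {A0 A1 : Type} (u : A0 → A1 → ℝ)
    (x : A0 → ℝ) (a1 : A1) : ℝ :=
  ∑' a0, x a0 * u a0 a1

/-- The follower best-response set `BR(x₀) = argmax_{a₁} ū₁(x₀, a₁)`. -/
def bestResponses {A0 A1 : Type} (u1 : A0 → A1 → ℝ) (x : A0 → ℝ) : Set A1 :=
  {a1 | ∀ b1, leaderExp u1 x b1 ≤ leaderExp u1 x a1}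

noncomputable def mixS (e : ℝ) (t : ℕ) : ℕ → ℝ :=
  fun a => if a = 0 then 1 - e else if a = t + 1 then e else 0

noncomputable def folU : ℕ → ℕ → ℝ :=
  fun a b => if b = 0 then 0 else if a = 0 then -(1 / ((b : ℝ) + 1))
    else if a = b then 1 else -1

noncomputable def leadU : ℕ → ℕ → ℝ := fun _ b => if b = 0 then 1 else 0

lemma mixS_hasSum (e : ℝ) (t : ℕ) (f : ℕ → ℝ) :
    HasSum (fun a => mixS e t a * f a) ((1 - e) * f 0 + e * f (t + 1)) := by
  have h : HasSum (fun a => mixS e t a * f a)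
      (∑ a ∈ ({0, t + 1} : Finset ℕ), mixS e t a * f a) := by
    apply hasSum_sum_of_ne_finset_zero
    intro b hb
    simp only [Finset.mem_insert, Finset.mem_singleton, not_or] at hb
    simp [mixS, hb.1, hb.2]
  rw [Finset.sum_pair (by simp)] at h
  simpa [mixS] using h

lemma leaderExp_mixS (u : ℕ → ℕ → ℝ) (e : ℝ) (t b : ℕ) :
    leaderExp u (mixS e t) b = (1 - e) * u 0 b + e * u (t + 1) b :=
  (mixS_hasSum e t (fun a => u a b)).tsum_eq

lemma mixS_sum_one (e : ℝ) (t : ℕ) : HasSum (mixS e t) 1 := by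
  simpa using mixS_hasSum e t (fun _ => 1)

lemma mixS_nonneg (e : ℝ) (t : ℕ) (h0 : 0 ≤ e) (h1 : e ≤ 1) (a : ℕ) : 0 ≤ mixS e t a := by
  unfold mixS
  split_ifs <;> linarith

lemma br_zero : bestResponses folU (mixS 0 0) = {0} := by
  ext a
  simp only [bestResponses, Set.mem_ofPred_eq, Set.mem_singleton_iff, leaderExp_mixS]
  constructor
  · intro h
    by_contra ha
    have h := h 0
    have : (0 : ℝ) < 1 / ((a : ℝ) + 1) := by positivity
    simp only [folU, ha, if_true, if_false] at h
    linarith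
  · rintro rfl b
    have : (0 : ℝ) < 1 / ((b : ℝ) + 1) := by positivity
    simp only [folU, if_true]
    split_ifs <;> linarith

lemma eps_bd (t : ℕ) : 0 < 1 / ((t : ℝ) + 2) ∧ 1 / ((t : ℝ) + 2) < 1 := by
  refine ⟨by positivity, ?_⟩
  rw [div_lt_one (by positivity)]
  have : (0 : ℝ) ≤ t := t.cast_nonneg
  linarith

lemma pay_self (t : ℕ) : 0 < leaderExp folU (mixS (1 / ((t : ℝ) + 2)) t) (t + 1) := by
  rw [leaderExp_mixS]
  obtain ⟨h0, h1⟩ := eps_bd t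
  have e : ((t + 1 : ℕ) : ℝ) + 1 = (t : ℝ) + 2 := by push_cast; ring
  simp only [folU, Nat.add_one_ne_zero, if_true, if_false, e]
  nlinarith

lemma pay_other (t b : ℕ) (hb : b ≠ t + 1) :
    leaderExp folU (mixS (1 / ((t : ℝ) + 2)) t) b ≤ 0 := by
  rw [leaderExp_mixS]
  obtain ⟨h0, h1⟩ := eps_bd t
  have : (0 : ℝ) < 1 / ((b : ℝ) + 1) := by positivity
  by_cases hb0 : b = 0
  · simp [folU, hb0]
  · simp only [folU, Nat.add_one_ne_zero, hb0, hb.symm, if_true, if_false]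
    nlinarith

lemma br_t (t : ℕ) : bestResponses folU (mixS (1 / ((t : ℝ) + 2)) t) = {t + 1} := by
  ext a
  simp only [bestResponses, Set.mem_ofPred_eq, Set.mem_singleton_iff]
  constructor
  · intro h
    by_contra ha
    linarith [h (t + 1), pay_self t, pay_other t a ha]
  · rintro rfl b
    by_cases hb : b = t + 1
    · rw [hb]
    · linarith [pay_self t, pay_other t b hb]

/-- Fragility of Stackelberg best responses: there is a
two-player Stackelberg game with countable action sets and bounded utilities,
a leader mixed strategy `x₀`, a sequence of leader mixed strategies `x₀⁽ᵗ⁾`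
with `‖x₀ − x₀⁽ᵗ⁾‖_∞ → 0`, and a constant `c > 0`, such that all the
best-response sets are nonempty and for every `t`,
`min_{a₁ ∈ BR(x₀)} ū₀(x₀, a₁) − max_{a₁ ∈ BR(x₀⁽ᵗ⁾)} ū₀(x₀, a₁) ≥ c`. -/
theorem stackelberg_best_response_fragility :
    ∃ (A0 A1 : Type) (_ : Countable A0) (_ : Countable A1)
      (u0 u1 : A0 → A1 → ℝ) (M : ℝ),
      (∀ a0 a1, |u0 a0 a1| ≤ M) ∧ (∀ a0 a1, |u1 a0 a1| ≤ M) ∧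
      ∃ (x0 : A0 → ℝ) (xs : ℕ → A0 → ℝ),
        (∀ a0, 0 ≤ x0 a0) ∧ HasSum x0 1 ∧
        (∀ t a0, 0 ≤ xs t a0) ∧ (∀ t, HasSum (xs t) 1) ∧
        Filter.Tendsto (fun t => ⨆ a0, |x0 a0 - xs t a0|)
          Filter.atTop (nhds 0) ∧
        ∃ c : ℝ, 0 < c ∧
          (bestResponses u1 x0).Nonempty ∧
          (∀ t, (bestResponses u1 (xs t)).Nonempty) ∧
          ∀ t, ∀ a1 ∈ bestResponses u1 x0, ∀ b1 ∈ bestResponses u1 (xs t),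
            leaderExp u0 x0 a1 - leaderExp u0 x0 b1 ≥ c := by
  refine ⟨ℕ, ℕ, inferInstance, inferInstance, leadU, folU, 1, ?_, ?_, mixS 0 0,
    fun t => mixS (1 / ((t : ℝ) + 2)) t, ?_, mixS_sum_one _ _, ?_,
    fun t => mixS_sum_one _ _, ?_, 1, one_pos, ?_, ?_, ?_⟩
  · intro a b
    unfold leadU
    split_ifs <;> simp
  · intro a b
    unfold folU
    split_ifs
    · simp
    · rw [abs_neg, abs_of_pos (by positivity), div_le_one (by positivity)]
      simp
    · simp
    · simp
  · exact mixS_nonneg _ _ le_rfl zero_le_one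
  · exact fun t => mixS_nonneg _ _ (eps_bd t).1.le (eps_bd t).2.le
  · have hlim : Filter.Tendsto (fun t : ℕ => 1 / ((t : ℝ) + 2)) Filter.atTop (nhds 0) := by
      have := (Filter.tendsto_add_atTop_iff_nat 2).2 (tendsto_one_div_atTop_nhds_zero_nat (𝕜 := ℝ))
      simpa using this
    refine squeeze_zero (fun t => Real.iSup_nonneg fun a => abs_nonneg _) (fun t => ?_) hlim
    apply ciSup_le
    intro a
    have h0 := (eps_bd t).1
    simp only [mixS]
    rw [abs_le]
    split_ifs <;> constructor <;> linarith
  · rw [br_zero]; exact Set.singleton_nonempty _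
  · intro t
    rw [br_t]; exact Set.singleton_nonempty _
  · intro t a ha b hb
    rw [br_zero] at ha
    rw [br_t] at hb
    rw [Set.mem_singleton_iff] at ha hb
    subst ha hb
    simp [leaderExp_mixS, leadU]
end
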